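/- arXiv:2201.09928 — 3 statements merged into one kernel-verified Lean document; each statement's English description precedes it below -/
import Mathlib

section
/- For every STL formula φ, the robustness map (ξ, t) ↦ ρ(φ, ξ, t) is continuous as a function on C_b([0,∞), ℝⁿ) × [0,∞), where C_b([0,∞), ℝⁿ) is the space of bounded continuous functions [0,∞) → ℝⁿ equipped with the supremum norm and [0,∞) carries its standard topology. -/
open scoped BoundedContinuousFunction

/-- Nonnegative time axis `[0,∞)`. -/
abbrev Time : Type := {t : ℝ // 0 ≤ t}

/-- A trajectory: a bounded continuous function `[0,∞) → ℝⁿ`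
(`Fin n → ℝ` carries the sup norm). -/
abbrev Traj (n : ℕ) : Type := BoundedContinuousFunction Time (Fin n → ℝ)

/-- STL formulae: atomic predicates given by continuous functions `f_π : ℝⁿ → ℝ`
(asserting `f_π ≥ 0`), negation, conjunction, and until `U_[a,b]` with `0 ≤ a < b`. -/
inductive STLFormula (n : ℕ) : Type
  | atom : C((Fin n → ℝ), ℝ) → STLFormula n
  | not : STLFormula n → STLFormula n
  | and : STLFormula n → STLFormula n → STLFormula n
  | until_ (a b : ℝ) (ha : 0 ≤ a) (hab : a < b) :
      STLFormula n → STLFormula n → STLFormula n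

/-- Quantitative semantics (robustness) of STL. -/
noncomputable def robust {n : ℕ} (ξ : Traj n) : STLFormula n → Time → ℝ
  | .atom f, t => f (ξ t)
  | .not φ, t => - robust ξ φ t
  | .and φ ψ, t => min (robust ξ φ t) (robust ξ ψ t)
  | .until_ a b ha hab φ ψ, t =>
      sSup ((fun t' : Time =>
          min (robust ξ ψ t')
            (sInf ((fun t'' : Time => robust ξ φ t'') '' Set.Icc t t'))) ''
        Set.Icc (⟨t.1 + a, add_nonneg t.2 ha⟩ : Time)
          (⟨t.1 + b, add_nonneg t.2 (ha.trans hab.le)⟩ : Time))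

/-- Affine interpolation between two times. -/
noncomputable def timeLerp (l u : Time) (s : ℝ) : Time :=
  ⟨|l.1 + s * (u.1 - l.1)|, abs_nonneg _⟩

lemma timeLerp_image (l u : Time) (h : l ≤ u) :
    timeLerp l u '' Set.Icc (0 : ℝ) 1 = Set.Icc l u := by
  have h' : l.1 ≤ u.1 := h
  have hl := l.2
  ext x
  constructor
  · rintro ⟨s, ⟨h0, h1⟩, rfl⟩
    have e1 : 0 ≤ s * (u.1 - l.1) := mul_nonneg h0 (by linarith)
    have e2 : s * (u.1 - l.1) ≤ u.1 - l.1 := mul_le_of_le_one_left (by linarith) h1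
    have e3 : |l.1 + s * (u.1 - l.1)| = l.1 + s * (u.1 - l.1) := abs_of_nonneg (by linarith)
    constructor
    · change l.1 ≤ |l.1 + s * (u.1 - l.1)|
      linarith
    · change |l.1 + s * (u.1 - l.1)| ≤ u.1
      linarith
  · rintro ⟨h1, h2⟩
    have h1' : l.1 ≤ x.1 := h1
    have h2' : x.1 ≤ u.1 := h2
    rcases h'.eq_or_lt with he | hlt
    · refine ⟨0, by simp, Subtype.ext ?_⟩
      change |l.1 + 0 * (u.1 - l.1)| = x.1
      rw [zero_mul, add_zero, abs_of_nonneg hl]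
      linarith
    · have hp : 0 < u.1 - l.1 := by linarith
      refine ⟨(x.1 - l.1) / (u.1 - l.1), ⟨div_nonneg (by linarith) hp.le,
        (div_le_one hp).2 (by linarith)⟩, Subtype.ext ?_⟩
      change |l.1 + (x.1 - l.1) / (u.1 - l.1) * (u.1 - l.1)| = x.1
      rw [div_mul_cancel₀ _ hp.ne', add_sub_cancel, abs_of_nonneg x.2]

lemma continuous_comp_lerp {X : Type*} [TopologicalSpace X] {g : X → Time → ℝ}
    (hg : Continuous (fun p : X × Time => g p.1 p.2)) {l u : X → Time}
    (hl : Continuous l) (hu : Continuous u) :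
    Continuous (fun p : X × ℝ => g p.1 (timeLerp (l p.1) (u p.1) p.2)) := by
  have : Continuous (fun p : X × ℝ => timeLerp (l p.1) (u p.1) p.2) := by
    unfold timeLerp
    refine Continuous.subtype_mk ?_ _
    fun_prop
  exact hg.comp (continuous_fst.prodMk this)

lemma continuous_sSup_Icc {X : Type*} [TopologicalSpace X] {g : X → Time → ℝ}
    (hg : Continuous (fun p : X × Time => g p.1 p.2)) {l u : X → Time}
    (hl : Continuous l) (hu : Continuous u) (h : ∀ x, l x ≤ u x) :
    Continuous (fun x => sSup (g x '' Set.Icc (l x) (u x))) := by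
  have := IsCompact.continuous_sSup (f := fun x s => g x (timeLerp (l x) (u x) s))
    (isCompact_Icc (a := (0 : ℝ)) (b := 1)) (continuous_comp_lerp hg hl hu)
  convert this using 2 with x
  rw [← timeLerp_image _ _ (h x), Set.image_image]

lemma continuous_sInf_Icc {X : Type*} [TopologicalSpace X] {g : X → Time → ℝ}
    (hg : Continuous (fun p : X × Time => g p.1 p.2)) {l u : X → Time}
    (hl : Continuous l) (hu : Continuous u) (h : ∀ x, l x ≤ u x) :
    Continuous (fun x => sInf (g x '' Set.Icc (l x) (u x))) := by
  have := IsCompact.continuous_sInf (f := fun x s => g x (timeLerp (l x) (u x) s))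
    (isCompact_Icc (a := (0 : ℝ)) (b := 1)) (continuous_comp_lerp hg hl hu)
  convert this using 2 with x
  rw [← timeLerp_image _ _ (h x), Set.image_image]

/-- for every STL formula `φ`, the robustness map
`(ξ, t) ↦ ρ(φ, ξ, t)` is continuous on `C_b([0,∞), ℝⁿ) × [0,∞)`,
where the trajectory space carries the supremum-norm topology. -/
theorem robust_continuous {n : ℕ} (φ : STLFormula n) :
    Continuous (fun p : Traj n × Time => robust p.1 φ p.2) := by
  induction φ with
  | atom f =>
    simp only [robust]
    exact f.continuous.comp continuous_eval
  | not φ ih =>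
    simp only [robust]
    exact ih.neg
  | and φ ψ ih1 ih2 =>
    simp only [robust]
    exact ih1.min ih2
  | until_ a b ha hab φ ψ ih1 ih2 =>
    have hin : Continuous (fun q : (Traj n × Time) × Time =>
        sInf ((fun t'' : Time => robust q.1.1 φ t'') '' Set.Icc q.1.2 (max q.1.2 q.2))) := by
      refine continuous_sInf_Icc (g := fun (q : (Traj n × Time) × Time) t'' =>
        robust q.1.1 φ t'') ?_ (by fun_prop) (by fun_prop) (fun _ => le_max_left _ _)
      exact ih1.comp (f := fun p : ((Traj n × Time) × Time) × Time => (p.1.1.1, p.2))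
        (by fun_prop)
    have hmin : Continuous (fun q : (Traj n × Time) × Time => min (robust q.1.1 ψ q.2)
        (sInf ((fun t'' : Time => robust q.1.1 φ t'') '' Set.Icc q.1.2 (max q.1.2 q.2)))) :=
      (ih2.comp (f := fun p : (Traj n × Time) × Time => (p.1.1, p.2)) (by fun_prop)).min hin
    have key := continuous_sSup_Icc
      (g := fun (p : Traj n × Time) t' => min (robust p.1 ψ t')
        (sInf ((fun t'' : Time => robust p.1 φ t'') '' Set.Icc p.2 (max p.2 t'))))
      hmin
      (l := fun p => (⟨p.2.1 + a, add_nonneg p.2.2 ha⟩ : Time))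
      (u := fun p => (⟨p.2.1 + b, add_nonneg p.2.2 (ha.trans hab.le)⟩ : Time))
      (Continuous.subtype_mk (by fun_prop) _) (Continuous.subtype_mk (by fun_prop) _)
      (fun p => Subtype.mk_le_mk.2 (by linarith))
    convert key using 2 with p
    simp only [robust]
    congr 1
    refine Set.image_congr fun t' ht' => ?_
    have hle : p.2 ≤ t' := by
      refine le_trans ?_ ht'.1
      change p.2.1 ≤ p.2.1 + a
      linarith
    rw [max_eq_right hle]
end

section
/- Let A be a real symmetric positive semidefinite n×n matrix. Then the matrix obtained by applying the exponential function entrywise, i.e. the matrix E with E_{ij} = exp(A_{ij}), is also real symmetric positive semidefinite. -/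
lemma entrywise_pow_posSemidef {n : ℕ} (A : Matrix (Fin n) (Fin n) ℝ)
    (hA : A.PosSemidef) (k : ℕ) :
    (Matrix.of fun i j => (A i j) ^ k).PosSemidef := by
  induction k with
  | zero =>
    have h := Matrix.posSemidef_vecMulVec_self_star (fun _ : Fin n => (1 : ℝ))
    convert h using 1
    ext i j
    simp [Matrix.vecMulVec_apply]
  | succ k ih =>
    have e : (Matrix.of fun i j => A i j ^ (k + 1)) =
        (Matrix.of fun i j => A i j ^ k).hadamard A := by
      ext i j
      simp [Matrix.hadamard_apply, pow_succ]
    rw [e]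
    exact ih.hadamard hA

/-- if `A` is a real symmetric positive semidefinite `n × n` matrix,
then the entrywise exponential `E`, with `E i j = exp (A i j)`, is also real
symmetric positive semidefinite. -/
theorem entrywise_exp_posSemidef {n : ℕ} (A : Matrix (Fin n) (Fin n) ℝ)
    (hA : A.PosSemidef) :
    (Matrix.of fun i j => Real.exp (A i j)).PosSemidef := by
  refine Matrix.PosSemidef.of_dotProduct_mulVec_nonneg ?_ ?_
  · ext i j
    have h := hA.isHermitian.apply i j
    simp only [star_trivial] at h
    simp [Matrix.conjTranspose_apply, h]
  · intro x
    have hs : HasSum (fun k : ℕ => ∑ i, x i * ∑ j, ((A i j) ^ k / (k.factorial : ℝ)) * x j)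
        (∑ i, x i * ∑ j, Real.exp (A i j) * x j) := by
      refine hasSum_sum fun i _ => HasSum.mul_left _ (hasSum_sum fun j _ => HasSum.mul_right _ ?_)
      rw [Real.exp_eq_exp_ℝ]
      exact NormedSpace.expSeries_div_hasSum_exp (A i j)
    have h0 := hs.nonneg fun k => by
      have hk := (entrywise_pow_posSemidef A hA k).dotProduct_mulVec_nonneg x
      have h2 : ∑ i, x i * ∑ j, ((A i j) ^ k / (k.factorial : ℝ)) * x j =
          (∑ i, x i * ∑ j, (A i j) ^ k * x j) / (k.factorial : ℝ) := by
        simp only [Finset.sum_div, Finset.mul_sum]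
        refine Finset.sum_congr rfl fun i _ => Finset.sum_congr rfl fun j _ => ?_
        ring
      rw [h2]
      refine div_nonneg ?_ (by positivity)
      simpa [dotProduct, Matrix.mulVec] using hk
    simpa [dotProduct, Matrix.mulVec] using h0
end

section
/- Soundness of the quantitative semantics: for every STL formula φ, every trajectory ξ, and every t ≥ 0, if ρ(φ, ξ, t) > 0 then s(φ, ξ, t) = 1 (ξ satisfies φ at time t), and if ρ(φ, ξ, t) < 0 then s(φ, ξ, t) = 0 (ξ does not satisfy φ at time t). -/
open scoped BoundedContinuousFunction

/-- Boolean satisfaction of STL (`sats ξ φ t` means `s(φ, ξ, t) = 1`). -/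
def sats {n : ℕ} (ξ : Traj n) : STLFormula n → Time → Prop
  | .atom f, t => 0 ≤ f (ξ t)
  | .not φ, t => ¬ sats ξ φ t
  | .and φ ψ, t => sats ξ φ t ∧ sats ξ ψ t
  | .until_ a b ha hab φ ψ, t =>
      ∃ t' ∈ Set.Icc (⟨t.1 + a, add_nonneg t.2 ha⟩ : Time)
          (⟨t.1 + b, add_nonneg t.2 (ha.trans hab.le)⟩ : Time),
        sats ξ ψ t' ∧ ∀ t'' ∈ Set.Icc t t', sats ξ φ t''

/-- soundness of the quantitative semantics: for every STL formula `φ`,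
trajectory `ξ`, and time `t ≥ 0`, positive robustness implies satisfaction
(`s(φ,ξ,t) = 1`) and negative robustness implies non-satisfaction (`s(φ,ξ,t) = 0`). -/
theorem robust_soundness {n : ℕ} (φ : STLFormula n) (ξ : Traj n) (t : Time) :
    (0 < robust ξ φ t → sats ξ φ t) ∧ (robust ξ φ t < 0 → ¬ sats ξ φ t) := by
  induction φ generalizing t with
  | atom f =>
    simp only [robust, sats]
    exact ⟨fun h => h.le, fun h => not_le.mpr h⟩
  | not φ ih =>
    simp only [robust, sats]
    exact ⟨fun h => (ih t).2 (by linarith), fun h => not_not.mpr ((ih t).1 (by linarith))⟩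
  | and φ ψ ih1 ih2 =>
    simp only [robust, sats]
    refine ⟨fun h => ?_, fun h hs => ?_⟩
    · exact ⟨(ih1 t).1 (lt_min_iff.mp h).1, (ih2 t).1 (lt_min_iff.mp h).2⟩
    · rcases min_lt_iff.mp h with h | h
      · exact (ih1 t).2 h hs.1
      · exact (ih2 t).2 h hs.2
  | until_ a b ha hab φ ψ ih1 ih2 =>
    simp only [robust, sats]
    refine ⟨fun h => ?_, fun h hs => ?_⟩
    · have hx : ¬ ∀ t' ∈ Set.Icc (⟨t.1 + a, add_nonneg t.2 ha⟩ : Time)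
          (⟨t.1 + b, add_nonneg t.2 (ha.trans hab.le)⟩ : Time),
          min (robust ξ ψ t')
            (sInf ((fun t'' : Time => robust ξ φ t'') '' Set.Icc t t')) ≤ 0 := by
        intro hall
        refine absurd h (not_lt.mpr (Real.sSup_nonpos ?_))
        rintro _ ⟨t', ht', rfl⟩
        exact hall t' ht'
      push Not at hx
      obtain ⟨t', ht', hpos⟩ := hx
      obtain ⟨h1, h2⟩ := lt_min_iff.mp hpos
      refine ⟨t', ht', (ih2 t').1 h1, fun t'' ht'' => (ih1 t'').1 ?_⟩
      have hb : BddBelow ((fun t'' : Time => robust ξ φ t'') '' Set.Icc t t') := by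
        by_contra hb
        rw [Real.sInf_of_not_bddBelow hb] at h2
        exact lt_irrefl _ h2
      exact h2.trans_le (csInf_le hb ⟨t'', ht'', rfl⟩)
    · obtain ⟨t', ht', h1, h2⟩ := hs
      refine absurd h (not_lt.mpr (Real.sSup_nonneg' ⟨_, ⟨t', ht', rfl⟩, le_min ?_ ?_⟩))
      · exact not_lt.mp fun hn => (ih2 t').2 hn h1
      · apply Real.sInf_nonneg
        rintro _ ⟨t'', ht'', rfl⟩
        exact not_lt.mp fun hn => (ih1 t'').2 hn (h2 t'' ht'')
end
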